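/- Suppose μ_X/σ_X = μ_Y/σ_Y. Let n ≥ 1 and let Z̄_n = n⁻¹∑_{i=1}^n Z_i be the mean of n independent random variables each with law PN(μ_X,μ_Y;σ_X²,σ_Y²;ρ). Then for every function f : ℝ → ℝ of class C³ such that E|f^{(m)}(Z̄_n)| < ∞ for m = 0,1,2 and E|Z̄_n·f^{(m)}(Z̄_n)| < ∞ for m = 0,1,2,3, one has E[A₂f(Z̄_n)] = 0. -/

import Mathlib

open MeasureTheory ProbabilityTheory

/-- The product-normal law `PN(μX, μY; σX², σY²; ρ)`: the law of `X * Y` where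
`X = μX + σX * U`, `Y = μY + σY * (ρ * U + √(1 - ρ²) * V)` and `U, V` are independent
standard normal random variables. -/
noncomputable def PN (μX μY σX σY ρ : ℝ) : Measure ℝ :=
  Measure.map
    (fun p : ℝ × ℝ =>
      (μX + σX * p.1) * (μY + σY * (ρ * p.1 + Real.sqrt (1 - ρ ^ 2) * p.2)))
    ((gaussianReal 0 1).prod (gaussianReal 0 1))

/-- The law of the mean `Z̄ₙ = n⁻¹ ∑ᵢ Zᵢ` of `n` independent random variables with law
`PN(μX, μY; σX², σY²; ρ)`. -/
noncomputable def PNbar (n : ℕ) (μX μY σX σY ρ : ℝ) : Measure ℝ :=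
  Measure.map (fun ω : Fin n → ℝ => (∑ i, ω i) / (n : ℝ))
    (Measure.pi fun _ : Fin n => PN μX μY σX σY ρ)

/-- The third-order Stein operator `A₂` (with `s_n = σXσY/n`, `r_X = μX/σX`, `r_Y = μY/σY`). -/
noncomputable def A2 (n : ℕ) (μX μY σX σY ρ : ℝ) (f : ℝ → ℝ) (x : ℝ) : ℝ :=
  (σX * σY / (n : ℝ)) ^ 3 * (1 - ρ ^ 2) * (1 + ρ) * x * iteratedDeriv 3 f x
    + (σX * σY / (n : ℝ)) ^ 2 * (1 + ρ)
        * ((n : ℝ) * (σX * σY / (n : ℝ)) * (1 - ρ ^ 2) + (3 * ρ - 1) * x) * iteratedDeriv 2 f x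
    + (σX * σY / (n : ℝ))
        * ((n : ℝ) * (σX * σY / (n : ℝ))
              * (2 * ρ ^ 2 + ρ - 1 - (1 - ρ) * (μX / σX) * (μY / σY))
            - (3 * ρ + 1) * x) * iteratedDeriv 1 f x
    + (x - (n : ℝ) * (σX * σY / (n : ℝ)) * ρ - μX * μY) * f x

open Filter Topology
open scoped ENNReal NNReal

lemma hasDerivAt_gaussianPDFReal_std (x : ℝ) :
    HasDerivAt (gaussianPDFReal 0 1) (-x * gaussianPDFReal 0 1 x) x := by
  rw [gaussianPDFReal_def]
  have h : HasDerivAt (fun y : ℝ => -(y - 0) ^ 2 / (2 * ((1 : ℝ≥0) : ℝ))) (-x) x := by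
    refine ((((hasDerivAt_id x).sub_const 0).pow 2).neg.div_const
      (2 * ((1 : ℝ≥0) : ℝ))).congr_deriv ?_
    simp
    ring
  exact (h.exp.const_mul ((√(2 * Real.pi * ((1 : ℝ≥0) : ℝ)))⁻¹)).congr_deriv (by ring)

lemma integrable_gaussianReal_std_iff {g : ℝ → ℝ} :
    Integrable g (gaussianReal 0 1) ↔ Integrable (fun x => gaussianPDFReal 0 1 x * g x) := by
  rw [gaussianReal_of_var_ne_zero 0 one_ne_zero,
    integrable_withDensity_iff_integrable_smul' (measurable_gaussianPDF 0 1)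
      (ae_of_all _ fun _ => gaussianPDF_lt_top)]
  simp

/-- Gaussian integration by parts for the standard normal law. -/
lemma integral_mul_gaussianReal_eq_integral_deriv {g g' : ℝ → ℝ}
    (hd : ∀ x, HasDerivAt g (g' x) x) (hg : Integrable g (gaussianReal 0 1))
    (hxg : Integrable (fun x => x * g x) (gaussianReal 0 1))
    (hg' : Integrable g' (gaussianReal 0 1)) :
    ∫ x, x * g x ∂gaussianReal 0 1 = ∫ x, g' x ∂gaussianReal 0 1 := by
  rw [eq_comm, ← sub_eq_zero, ← integral_sub hg' hxg,
    integral_gaussianReal_eq_integral_smul one_ne_zero]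
  refine integral_eq_zero_of_hasDerivAt_of_integrable
    (f := fun x => gaussianPDFReal 0 1 x * g x) (fun x => ?_)
    (integrable_gaussianReal_std_iff.1 (hg'.sub hxg)) (integrable_gaussianReal_std_iff.1 hg)
  exact ((hasDerivAt_gaussianPDFReal_std x).mul (hd x)).congr_deriv
    (by simp only [smul_eq_mul]; ring)

/-- The standard Gaussian law on the plane. -/
noncomputable abbrev stdGaussianPlane : Measure (ℝ × ℝ) :=
  (gaussianReal 0 1).prod (gaussianReal 0 1)

lemma integral_fst_mul_stdGaussianPlane {G G' : ℝ × ℝ → ℝ}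
    (hd : ∀ p : ℝ × ℝ, HasDerivAt (fun u => G (u, p.2)) (G' p) p.1)
    (hG : Integrable G stdGaussianPlane)
    (huG : Integrable (fun p => p.1 * G p) stdGaussianPlane)
    (hG' : Integrable G' stdGaussianPlane) :
    ∫ p, p.1 * G p ∂stdGaussianPlane = ∫ p, G' p ∂stdGaussianPlane := by
  rw [integral_prod_symm _ huG, integral_prod_symm _ hG']
  refine integral_congr_ae ?_
  filter_upwards [hG.prod_left_ae, huG.prod_left_ae, hG'.prod_left_ae] with v h₁ h₂ h₃
  exact integral_mul_gaussianReal_eq_integral_deriv (fun u => hd (u, v)) h₁ h₂ h₃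

lemma integral_snd_mul_stdGaussianPlane {G G' : ℝ × ℝ → ℝ}
    (hd : ∀ p : ℝ × ℝ, HasDerivAt (fun v => G (p.1, v)) (G' p) p.2)
    (hG : Integrable G stdGaussianPlane)
    (hvG : Integrable (fun p => p.2 * G p) stdGaussianPlane)
    (hG' : Integrable G' stdGaussianPlane) :
    ∫ p, p.2 * G p ∂stdGaussianPlane = ∫ p, G' p ∂stdGaussianPlane := by
  rw [integral_prod _ hvG, integral_prod _ hG']
  refine integral_congr_ae ?_
  filter_upwards [hG.prod_right_ae, hvG.prod_right_ae, hG'.prod_right_ae] with u h₁ h₂ h₃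
  exact integral_mul_gaussianReal_eq_integral_deriv (fun v => hd (u, v)) h₁ h₂ h₃

/-- All moments of finite order of `f` under `μ` are finite. -/
def HasFiniteMoments {α : Type*} [MeasurableSpace α] (f : α → ℝ) (μ : Measure α) : Prop :=
  ∀ p : ℝ≥0∞, p ≠ ∞ → MemLp f p μ

namespace HasFiniteMoments

variable {α : Type*} [MeasurableSpace α] {μ : Measure α} {f g : α → ℝ}

lemma integrable (hf : HasFiniteMoments f μ) : Integrable f μ :=
  memLp_one_iff_integrable.1 (hf 1 ENNReal.one_ne_top)

lemma add (hf : HasFiniteMoments f μ) (hg : HasFiniteMoments g μ) :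
    HasFiniteMoments (fun x => f x + g x) μ :=
  fun p hp => (hf p hp).add (hg p hp)

lemma sub (hf : HasFiniteMoments f μ) (hg : HasFiniteMoments g μ) :
    HasFiniteMoments (fun x => f x - g x) μ :=
  fun p hp => (hf p hp).sub (hg p hp)

lemma const_mul (c : ℝ) (hf : HasFiniteMoments f μ) : HasFiniteMoments (fun x => c * f x) μ :=
  fun p hp => (hf p hp).const_mul c

lemma mul (hf : HasFiniteMoments f μ) (hg : HasFiniteMoments g μ) :
    HasFiniteMoments (fun x => f x * g x) μ := by
  intro p hp
  have : ENNReal.HolderTriple (2 * p) (2 * p) p := ⟨by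
    rw [ENNReal.mul_inv (by simp) (by simp), ← add_mul, ENNReal.inv_two_add_inv_two, one_mul]⟩
  have h2 : 2 * p ≠ ∞ := ENNReal.mul_ne_top (by simp) hp
  exact (hg _ h2).mul (hf _ h2)

lemma of_bounded [IsFiniteMeasure μ] (hf : AEStronglyMeasurable f μ) {C : ℝ}
    (hC : ∀ x, |f x| ≤ C) : HasFiniteMoments f μ :=
  fun _ _ => MemLp.of_bound hf C (ae_of_all _ hC)

lemma const [IsFiniteMeasure μ] (c : ℝ) : HasFiniteMoments (fun _ : α => c) μ :=
  fun _ _ => memLp_const c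

end HasFiniteMoments

lemma hasFiniteMoments_fst : HasFiniteMoments Prod.fst stdGaussianPlane :=
  fun p hp => (memLp_id_gaussianReal' p hp).comp_measurePreserving measurePreserving_fst

lemma hasFiniteMoments_snd : HasFiniteMoments Prod.snd stdGaussianPlane :=
  fun p hp => (memLp_id_gaussianReal' p hp).comp_measurePreserving measurePreserving_snd

/-- `g` is continuous and bounded. -/
def IsBoundedContinuous (g : ℝ → ℝ) : Prop := Continuous g ∧ ∃ C, ∀ x, |g x| ≤ C

namespace IsBoundedContinuous

variable {f g : ℝ → ℝ}

lemma add (hf : IsBoundedContinuous f) (hg : IsBoundedContinuous g) :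
    IsBoundedContinuous (fun x => f x + g x) := by
  obtain ⟨hf, C, hC⟩ := hf
  obtain ⟨hg, D, hD⟩ := hg
  exact ⟨hf.add hg, C + D, fun x => (abs_add_le _ _).trans (add_le_add (hC x) (hD x))⟩

lemma const_mul (c : ℝ) (hf : IsBoundedContinuous f) : IsBoundedContinuous (fun x => c * f x) := by
  obtain ⟨hf, C, hC⟩ := hf
  refine ⟨hf.const_mul c, |c| * C, fun x => ?_⟩
  rw [abs_mul]
  exact mul_le_mul_of_nonneg_left (hC x) (abs_nonneg c)

lemma comp (hf : IsBoundedContinuous f) (hg : Continuous g) :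
    IsBoundedContinuous (fun x => f (g x)) :=
  ⟨hf.1.comp hg, hf.2.imp fun _ hC x => hC (g x)⟩

lemma hasFiniteMoments_comp {α : Type*} [MeasurableSpace α] {μ : Measure α} [IsFiniteMeasure μ]
    (hf : IsBoundedContinuous f) {T : α → ℝ} (hT : AEMeasurable T μ) :
    HasFiniteMoments (fun x => f (T x)) μ := by
  obtain ⟨hf, C, hC⟩ := hf
  exact .of_bounded (hf.measurable.comp_aemeasurable hT).aestronglyMeasurable fun x => hC (T x)

end IsBoundedContinuous

/-- `G` has finite moments of every order and mean zero under the standard Gaussian law on the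
plane. -/
def IsGaussianCentered (G : ℝ × ℝ → ℝ) : Prop :=
  HasFiniteMoments G stdGaussianPlane ∧ ∫ p, G p ∂stdGaussianPlane = 0

namespace IsGaussianCentered

variable {G H : ℝ × ℝ → ℝ}

lemma add (hG : IsGaussianCentered G) (hH : IsGaussianCentered H) :
    IsGaussianCentered (fun p => G p + H p) :=
  ⟨hG.1.add hH.1, by rw [integral_add hG.1.integrable hH.1.integrable, hG.2, hH.2, add_zero]⟩

lemma const_mul (c : ℝ) (hG : IsGaussianCentered G) : IsGaussianCentered (fun p => c * G p) :=
  ⟨hG.1.const_mul c, by rw [integral_const_mul, hG.2, mul_zero]⟩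

lemma of_hasDerivAt {G Gu Gv : ℝ × ℝ → ℝ}
    (hu : ∀ p : ℝ × ℝ, HasDerivAt (fun u => G (u, p.2)) (Gu p) p.1)
    (hv : ∀ p : ℝ × ℝ, HasDerivAt (fun v => G (p.1, v)) (Gv p) p.2)
    (hG : HasFiniteMoments G stdGaussianPlane) (hGu : HasFiniteMoments Gu stdGaussianPlane)
    (hGv : HasFiniteMoments Gv stdGaussianPlane) (c d : ℝ) :
    IsGaussianCentered (fun p => (c * p.1 + d * p.2) * G p - (c * Gu p + d * Gv p)) := by
  have h₁ : IsGaussianCentered (fun p => p.1 * G p - Gu p) := by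
    refine ⟨(hasFiniteMoments_fst.mul hG).sub hGu, ?_⟩
    rw [integral_sub (hasFiniteMoments_fst.mul hG).integrable hGu.integrable, sub_eq_zero]
    exact integral_fst_mul_stdGaussianPlane hu hG.integrable
      (hasFiniteMoments_fst.mul hG).integrable hGu.integrable
  have h₂ : IsGaussianCentered (fun p => p.2 * G p - Gv p) := by
    refine ⟨(hasFiniteMoments_snd.mul hG).sub hGv, ?_⟩
    rw [integral_sub (hasFiniteMoments_snd.mul hG).integrable hGv.integrable, sub_eq_zero]
    exact integral_snd_mul_stdGaussianPlane hv hG.integrable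
      (hasFiniteMoments_snd.mul hG).integrable hGv.integrable
  convert (h₁.const_mul c).add (h₂.const_mul d) using 2 with p
  ring

end IsGaussianCentered

section Plane

variable {r ρ κ s : ℝ}

/-- The product `s X Y` of two affine functions on the plane, where `X` and `Y` have the same
mean `r`. -/
noncomputable def planeProduct (r ρ κ s : ℝ) (p : ℝ × ℝ) : ℝ :=
  s * ((r + p.1) * (r + ρ * p.1 + κ * p.2))

lemma measurable_planeProduct : Measurable (planeProduct r ρ κ s) := by
  unfold planeProduct
  fun_prop

lemma hasFiniteMoments_affine (a c d : ℝ) :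
    HasFiniteMoments (fun p : ℝ × ℝ => a + c * p.1 + d * p.2) stdGaussianPlane :=
  ((HasFiniteMoments.const a).add (hasFiniteMoments_fst.const_mul c)).add
    (hasFiniteMoments_snd.const_mul d)

lemma hasFiniteMoments_planeProduct :
    HasFiniteMoments (planeProduct r ρ κ s) stdGaussianPlane := by
  convert ((hasFiniteMoments_affine r 1 0).mul (hasFiniteMoments_affine r ρ κ)).const_mul s
    using 2 with p
  simp [planeProduct]

/-- Gaussian integration by parts against an affine function times a function of the product. -/
lemma isGaussianCentered_affine {g g' : ℝ → ℝ} (hd : ∀ x, HasDerivAt g (g' x) x)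
    (hg : IsBoundedContinuous g) (hg' : IsBoundedContinuous g') (k l m c d : ℝ) :
    IsGaussianCentered (fun p =>
      (c * p.1 + d * p.2) * ((k + l * p.1 + m * p.2) * g (planeProduct r ρ κ s p))
      - (c * (l * g (planeProduct r ρ κ s p) + (k + l * p.1 + m * p.2)
          * (g' (planeProduct r ρ κ s p)
            * (s * (r + ρ * p.1 + κ * p.2 + ρ * (r + p.1)))))
        + d * (m * g (planeProduct r ρ κ s p) + (k + l * p.1 + m * p.2)
          * (g' (planeProduct r ρ κ s p) * (s * (κ * (r + p.1))))))) := by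
  have hgZ := hg.hasFiniteMoments_comp (μ := stdGaussianPlane)
    (measurable_planeProduct (r := r) (ρ := ρ) (κ := κ) (s := s)).aemeasurable
  have hgZ' := hg'.hasFiniteMoments_comp (μ := stdGaussianPlane)
    (measurable_planeProduct (r := r) (ρ := ρ) (κ := κ) (s := s)).aemeasurable
  have hL := hasFiniteMoments_affine k l m
  have hX : HasFiniteMoments (fun p : ℝ × ℝ => s * (κ * (r + p.1))) stdGaussianPlane :=
    (((HasFiniteMoments.const r).add hasFiniteMoments_fst).const_mul κ).const_mul s
  have hY : HasFiniteMoments (fun p : ℝ × ℝ => s * (r + ρ * p.1 + κ * p.2 + ρ * (r + p.1)))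
      stdGaussianPlane :=
    ((hasFiniteMoments_affine r ρ κ).add
      (((HasFiniteMoments.const r).add hasFiniteMoments_fst).const_mul ρ)).const_mul s
  refine .of_hasDerivAt (fun p => ?_) (fun p => ?_) (hL.mul hgZ)
    ((hgZ.const_mul l).add (hL.mul (hgZ'.mul hY))) ((hgZ.const_mul m).add (hL.mul (hgZ'.mul hX)))
    c d
  · have hZ : HasDerivAt (fun u => planeProduct r ρ κ s (u, p.2))
        (s * (r + ρ * p.1 + κ * p.2 + ρ * (r + p.1))) p.1 := by
      have h₁ := (hasDerivAt_id p.1).const_add r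
      have h₂ := (((hasDerivAt_id p.1).const_mul ρ).const_add r).add_const (κ * p.2)
      exact ((h₁.mul h₂).const_mul s).congr_deriv (by simp only [id]; ring)
    have h₃ := (((hasDerivAt_id p.1).const_mul l).const_add k).add_const (m * p.2)
    exact (h₃.mul ((hd _).comp p.1 hZ)).congr_deriv (by simp only [id, Function.comp]; ring)
  · have hZ : HasDerivAt (fun v => planeProduct r ρ κ s (p.1, v)) (s * (κ * (r + p.1))) p.2 := by
      have h₂ := ((hasDerivAt_id p.2).const_mul κ).const_add (r + ρ * p.1)
      exact ((h₂.const_mul (r + p.1)).const_mul s).congr_deriv (by ring)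
    have h₃ := ((hasDerivAt_id p.2).const_mul m).const_add (k + l * p.1)
    exact (h₃.mul ((hd _).comp p.2 hZ)).congr_deriv (by simp only [id, Function.comp]; ring)

variable {g g' : ℝ → ℝ}

lemma isGaussianCentered_difference_sq (hκ : κ ^ 2 = 1 - ρ ^ 2)
    (hd : ∀ x, HasDerivAt g (g' x) x) (hg : IsBoundedContinuous g)
    (hg' : IsBoundedContinuous g') :
    IsGaussianCentered (fun p => ((1 - ρ) * p.1 - κ * p.2) ^ 2
        * (g (planeProduct r ρ κ s p) + (1 - ρ) * s * g' (planeProduct r ρ κ s p))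
      - 2 * (1 - ρ) * g (planeProduct r ρ κ s p)) := by
  convert isGaussianCentered_affine hd hg hg' 0 (1 - ρ) (-κ) (1 - ρ) (-κ) using 2 with p
  linear_combination (g (planeProduct r ρ κ s p)
    - ((1 - ρ) * p.1 - κ * p.2) * s * (r + p.1) * g' (planeProduct r ρ κ s p)) * hκ

lemma isGaussianCentered_sum (hκ : κ ^ 2 = 1 - ρ ^ 2)
    (hd : ∀ x, HasDerivAt g (g' x) x) (hg : IsBoundedContinuous g)
    (hg' : IsBoundedContinuous g') :
    IsGaussianCentered (fun p => (2 * r + (1 + ρ) * p.1 + κ * p.2)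
        * (g (planeProduct r ρ κ s p) - (1 + ρ) * s * g' (planeProduct r ρ κ s p))
      - 2 * r * g (planeProduct r ρ κ s p)) := by
  convert isGaussianCentered_affine hd hg hg' 1 0 0 (1 + ρ) κ using 2 with p
  linear_combination (s * (r + p.1) * g' (planeProduct r ρ κ s p)) * hκ

lemma isGaussianCentered_sum_sq (hκ : κ ^ 2 = 1 - ρ ^ 2)
    (hd : ∀ x, HasDerivAt g (g' x) x) (hg : IsBoundedContinuous g)
    (hg' : IsBoundedContinuous g') :
    IsGaussianCentered (fun p => (2 * r + (1 + ρ) * p.1 + κ * p.2) ^ 2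
        * (g (planeProduct r ρ κ s p) - (1 + ρ) * s * g' (planeProduct r ρ κ s p))
      - 2 * (1 + ρ) * g (planeProduct r ρ κ s p)
      - 2 * r * ((2 * r + (1 + ρ) * p.1 + κ * p.2) * g (planeProduct r ρ κ s p))) := by
  convert isGaussianCentered_affine hd hg hg' (2 * r) (1 + ρ) κ (1 + ρ) κ using 2 with p
  linear_combination (g (planeProduct r ρ κ s p) + (2 * r + (1 + ρ) * p.1 + κ * p.2)
    * s * (r + p.1) * g' (planeProduct r ρ κ s p)) * hκ

lemma integral_stein_planeProduct (hκ : κ ^ 2 = 1 - ρ ^ 2) {f₀ f₁ f₂ f₃ : ℝ → ℝ}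
    (h₀ : ∀ x, HasDerivAt f₀ (f₁ x) x) (h₁ : ∀ x, HasDerivAt f₁ (f₂ x) x)
    (h₂ : ∀ x, HasDerivAt f₂ (f₃ x) x) (b₀ : IsBoundedContinuous f₀)
    (b₁ : IsBoundedContinuous f₁) (b₂ : IsBoundedContinuous f₂) (b₃ : IsBoundedContinuous f₃) :
    ∫ p, (s ^ 3 * (1 - ρ ^ 2) * (1 + ρ) * planeProduct r ρ κ s p * f₃ (planeProduct r ρ κ s p)
      + s ^ 2 * (1 + ρ) * (s * (1 - ρ ^ 2) + (3 * ρ - 1) * planeProduct r ρ κ s p)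
        * f₂ (planeProduct r ρ κ s p)
      + s * (s * (2 * ρ ^ 2 + ρ - 1 - (1 - ρ) * r ^ 2) - (3 * ρ + 1) * planeProduct r ρ κ s p)
        * f₁ (planeProduct r ρ κ s p)
      + (planeProduct r ρ κ s p - s * ρ - s * r ^ 2) * f₀ (planeProduct r ρ κ s p))
      ∂stdGaussianPlane = 0 := by
  have hF : ∀ x, HasDerivAt (fun x => f₀ x + (1 - ρ) * s * f₁ x)
      (f₁ x + (1 - ρ) * s * f₂ x) x := fun x => (h₀ x).add ((h₁ x).const_mul _)
  have hF' : ∀ x, HasDerivAt (fun x => f₁ x + (1 - ρ) * s * f₂ x)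
      (f₂ x + (1 - ρ) * s * f₃ x) x := fun x => (h₁ x).add ((h₂ x).const_mul _)
  have bF := b₀.add (b₁.const_mul ((1 - ρ) * s))
  have bF' := b₁.add (b₂.const_mul ((1 - ρ) * s))
  have bF'' := b₂.add (b₃.const_mul ((1 - ρ) * s))
  have i₁ := isGaussianCentered_sum (r := r) hκ hF bF bF' (s := s)
  have i₂ := isGaussianCentered_sum_sq (r := r) (s := s) hκ
    (fun x => (hF x).add ((hF' x).const_mul (-(1 + ρ) * s)))
    (bF.add (bF'.const_mul (-(1 + ρ) * s))) (bF'.add (bF''.const_mul (-(1 + ρ) * s)))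
  have i₃ := isGaussianCentered_difference_sq (r := r) (s := s) hκ
    (fun x => (h₀ x).add (((h₁ x).const_mul (-2 * (1 + ρ) * s)).add
      ((h₂ x).const_mul ((1 + ρ) ^ 2 * s ^ 2))))
    (b₀.add ((b₁.const_mul (-2 * (1 + ρ) * s)).add (b₂.const_mul ((1 + ρ) ^ 2 * s ^ 2))))
    (b₁.add ((b₂.const_mul (-2 * (1 + ρ) * s)).add (b₃.const_mul ((1 + ρ) ^ 2 * s ^ 2))))
  have i := ((i₂.add (i₁.const_mul (2 * r))).add (i₃.const_mul (-1))).const_mul (s / 4)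
  refine (integral_congr_ae (ae_of_all _ fun p => ?_)).trans i.2
  have hZ : planeProduct r ρ κ s p = s / 4 * ((2 * r + (1 + ρ) * p.1 + κ * p.2) ^ 2
      - ((1 - ρ) * p.1 - κ * p.2) ^ 2) := by
    rw [planeProduct]
    ring
  simp only [Pi.add_apply]
  generalize f₀ (planeProduct r ρ κ s p) = y₀
  generalize f₁ (planeProduct r ρ κ s p) = y₁
  generalize f₂ (planeProduct r ρ κ s p) = y₂
  generalize f₃ (planeProduct r ρ κ s p) = y₃
  rw [hZ]
  ring

end Plane

lemma ContDiff.hasDerivAt_iteratedDeriv {f : ℝ → ℝ} {n k : ℕ} (hf : ContDiff ℝ n f) (hk : k < n)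
    (x : ℝ) : HasDerivAt (iteratedDeriv k f) (iteratedDeriv (k + 1) f x) x := by
  rw [iteratedDeriv_succ]
  exact (hf.differentiable_iteratedDeriv k (by exact_mod_cast hk) x).hasDerivAt

lemma HasCompactSupport.iteratedDeriv_real {f : ℝ → ℝ} (hf : HasCompactSupport f) (k : ℕ) :
    HasCompactSupport (iteratedDeriv k f) := by
  induction k with
  | zero => simpa using hf
  | succ k ih => rw [iteratedDeriv_succ]; exact ih.deriv

lemma IsBoundedContinuous.iteratedDeriv_of_hasCompactSupport {f : ℝ → ℝ} {n k : ℕ}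
    (hf : ContDiff ℝ n f) (hc : HasCompactSupport f) (hk : k ≤ n) :
    IsBoundedContinuous (iteratedDeriv k f) := by
  have h := hf.continuous_iteratedDeriv k (by exact_mod_cast hk)
  exact ⟨h, h.bounded_above_of_compact_support (hc.iteratedDeriv_real k)⟩

lemma tendsto_integral_comp_mul_mul {μ : Measure ℝ} {R w : ℝ → ℝ} {ε : ℕ → ℝ}
    (hw : IsBoundedContinuous w) (hR : Integrable R μ) (hε : Tendsto ε atTop (𝓝 0)) :
    Tendsto (fun k => ∫ x, w (ε k * x) * R x ∂μ) atTop (𝓝 (w 0 * ∫ x, R x ∂μ)) := by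
  obtain ⟨hw, C, hC⟩ := hw
  rw [← integral_const_mul]
  refine tendsto_integral_of_dominated_convergence (fun x => C * ‖R x‖) (fun k => ?_)
    (hR.norm.const_mul C) (fun k => ae_of_all _ fun x => ?_) (ae_of_all _ fun x => ?_)
  · exact (hw.comp (continuous_const.mul continuous_id)).aestronglyMeasurable.mul
      hR.aestronglyMeasurable
  · rw [norm_mul]
    exact mul_le_mul_of_nonneg_right (hC _) (norm_nonneg _)
  · have : Tendsto (fun k => ε k * x) atTop (𝓝 0) := by simpa using hε.mul_const x
    exact ((hw.tendsto 0).comp this).mul_const _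

/-- A third-order differential identity with affine coefficients that holds in mean for compactly
supported functions extends to all functions for which the terms are integrable. -/
lemma integral_thirdOrder_eq_zero_of_hasCompactSupport {μ : Measure ℝ}
    {a₀ a₁ a₂ a₃ c₀ c₁ c₂ : ℝ}
    (H : ∀ g : ℝ → ℝ, ContDiff ℝ 3 g → HasCompactSupport g →
      ∫ x, (x * (a₃ * iteratedDeriv 3 g x + a₂ * iteratedDeriv 2 g x + a₁ * iteratedDeriv 1 g x
        + a₀ * g x) + (c₂ * iteratedDeriv 2 g x + c₁ * iteratedDeriv 1 g x + c₀ * g x)) ∂μ = 0)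
    {f : ℝ → ℝ} (hf : ContDiff ℝ 3 f) (hint : ∀ m ≤ 2, Integrable (iteratedDeriv m f) μ)
    (hintx : ∀ m ≤ 3, Integrable (fun x => x * iteratedDeriv m f x) μ) :
    ∫ x, (x * (a₃ * iteratedDeriv 3 f x + a₂ * iteratedDeriv 2 f x + a₁ * iteratedDeriv 1 f x
      + a₀ * f x) + (c₂ * iteratedDeriv 2 f x + c₁ * iteratedDeriv 1 f x + c₀ * f x)) ∂μ = 0 := by
  let χ : ContDiffBump (0 : ℝ) := ⟨1, 2, one_pos, one_lt_two⟩
  have hχ : ContDiff ℝ 3 χ := χ.contDiff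
  have bχ : ∀ k ≤ 3, IsBoundedContinuous (iteratedDeriv k χ) := fun k hk =>
    .iteratedDeriv_of_hasCompactSupport (n := 3) hχ χ.hasCompactSupport hk
  have hχ0 : χ 0 = 1 := χ.one_of_mem_closedBall (by simp [χ])
  have hε := tendsto_one_div_add_atTop_nhds_zero_nat (𝕜 := ℝ)
  set ε : ℕ → ℝ := fun k => 1 / ((k : ℝ) + 1) with hεdef
  have i₀ : Integrable f μ := by simpa using hint 0 (by norm_num)
  have i₁ := hint 1 (by norm_num)
  have i₂ := hint 2 le_rfl
  have j₀ : Integrable (fun x => x * f x) μ := by simpa using hintx 0 (by norm_num)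
  have j₁ := hintx 1 (by norm_num)
  have j₂ := hintx 2 (by norm_num)
  have j₃ := hintx 3 le_rfl
  set R₀ : ℝ → ℝ := fun x => x * (a₃ * iteratedDeriv 3 f x + a₂ * iteratedDeriv 2 f x
    + a₁ * iteratedDeriv 1 f x + a₀ * f x)
    + (c₂ * iteratedDeriv 2 f x + c₁ * iteratedDeriv 1 f x + c₀ * f x) with hR₀
  set R₁ : ℝ → ℝ := fun x => x * (3 * a₃ * iteratedDeriv 2 f x + 2 * a₂ * iteratedDeriv 1 f x
    + a₁ * f x) + (2 * c₂ * iteratedDeriv 1 f x + c₁ * f x) with hR₁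
  set R₂ : ℝ → ℝ := fun x => x * (3 * a₃ * iteratedDeriv 1 f x + a₂ * f x) + c₂ * f x with hR₂
  set R₃ : ℝ → ℝ := fun x => a₃ * (x * f x) with hR₃
  have I₀ : Integrable R₀ μ :=
    (((((j₃.const_mul a₃).add (j₂.const_mul a₂)).add (j₁.const_mul a₁)).add
      (j₀.const_mul a₀)).add (((i₂.const_mul c₂).add (i₁.const_mul c₁)).add
      (i₀.const_mul c₀))).congr (ae_of_all _ fun x => by simp only [hR₀, Pi.add_apply]; ring)
  have I₁ : Integrable R₁ μ :=
    ((((j₂.const_mul (3 * a₃)).add (j₁.const_mul (2 * a₂))).add (j₀.const_mul a₁)).add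
      ((i₁.const_mul (2 * c₂)).add (i₀.const_mul c₁))).congr
      (ae_of_all _ fun x => by simp only [hR₁, Pi.add_apply]; ring)
  have I₂ : Integrable R₂ μ :=
    (((j₁.const_mul (3 * a₃)).add (j₀.const_mul a₂)).add (i₀.const_mul c₂)).congr
      (ae_of_all _ fun x => by simp only [hR₂, Pi.add_apply]; ring)
  have I₃ : Integrable R₃ μ := j₀.const_mul a₃
  have bddInt : ∀ (k m : ℕ) (R : ℝ → ℝ), m ≤ 3 → Integrable R μ →
      Integrable (fun x => iteratedDeriv m χ (ε k * x) * R x) μ := by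
    intro k m R hm hR
    obtain ⟨hc, C, hC⟩ := (bχ m hm).comp (continuous_const.mul continuous_id : Continuous
      fun x : ℝ => ε k * x)
    exact hR.bdd_mul hc.aestronglyMeasurable (ae_of_all _ hC)
  have key : ∀ k, (∫ x, iteratedDeriv 0 χ (ε k * x) * R₀ x ∂μ)
      + ε k * (∫ x, iteratedDeriv 1 χ (ε k * x) * R₁ x ∂μ)
      + ε k ^ 2 * (∫ x, iteratedDeriv 2 χ (ε k * x) * R₂ x ∂μ)
      + ε k ^ 3 * (∫ x, iteratedDeriv 3 χ (ε k * x) * R₃ x ∂μ) = 0 := by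
    intro k
    have hpos : ε k ≠ 0 := by simp only [hεdef]; positivity
    have hχk : ContDiff ℝ 3 (fun x => χ (ε k * x)) := hχ.comp (contDiff_const.mul contDiff_id)
    have hcs : HasCompactSupport (fun x => χ (ε k * x) * f x) := by
      refine HasCompactSupport.mul_right ?_
      exact χ.hasCompactSupport.comp_homeomorph (Homeomorph.mulLeft₀ (ε k) hpos)
    have hL : ∀ m ≤ 3, ∀ x, iteratedDeriv m (fun x => χ (ε k * x) * f x) x
        = ∑ i ∈ Finset.range (m + 1), (m.choose i : ℝ)
          * (ε k ^ i * iteratedDeriv i χ (ε k * x)) * iteratedDeriv (m - i) f x := by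
      intro m hm x
      have hm' : (m : WithTop ℕ∞) ≤ 3 := by exact_mod_cast hm
      rw [iteratedDeriv_fun_mul (hχk.of_le hm').contDiffAt (hf.of_le hm').contDiffAt]
      refine Finset.sum_congr rfl fun i hi => ?_
      have hi' : (i : WithTop ℕ∞) ≤ 3 := by
        have := Finset.mem_range.1 hi
        exact_mod_cast (by omega : i ≤ 3)
      rw [iteratedDeriv_comp_const_mul (hχ.of_le hi')]
    have t₀ := bddInt k 0 _ (by norm_num) I₀
    have t₁ := (bddInt k 1 _ (by norm_num) I₁).const_mul (ε k)
    have t₂ := (bddInt k 2 _ (by norm_num) I₂).const_mul (ε k ^ 2)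
    have t₃ := (bddInt k 3 _ le_rfl I₃).const_mul (ε k ^ 3)
    have t₀₁ : Integrable (fun x => iteratedDeriv 0 χ (ε k * x) * R₀ x
      + ε k * (iteratedDeriv 1 χ (ε k * x) * R₁ x)) μ := t₀.add t₁
    have t₀₁₂ : Integrable (fun x => iteratedDeriv 0 χ (ε k * x) * R₀ x
      + ε k * (iteratedDeriv 1 χ (ε k * x) * R₁ x)
      + ε k ^ 2 * (iteratedDeriv 2 χ (ε k * x) * R₂ x)) μ := t₀₁.add t₂
    rw [← integral_const_mul, ← integral_const_mul, ← integral_const_mul, ← integral_add t₀ t₁,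
      ← integral_add t₀₁ t₂, ← integral_add t₀₁₂ t₃]
    refine (integral_congr_ae (ae_of_all _ fun x => ?_)).trans (H _ (hχk.mul hf) hcs)
    simp only [hL 3 le_rfl x, hL 2 (by norm_num) x, hL 1 (by norm_num) x, hR₀, hR₁, hR₂, hR₃,
      Finset.sum_range_succ, Finset.sum_range_zero, iteratedDeriv_zero]
    norm_num [Nat.choose]
    ring
  have hlim : Tendsto (fun k => (∫ x, iteratedDeriv 0 χ (ε k * x) * R₀ x ∂μ)
      + ε k * (∫ x, iteratedDeriv 1 χ (ε k * x) * R₁ x ∂μ)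
      + ε k ^ 2 * (∫ x, iteratedDeriv 2 χ (ε k * x) * R₂ x ∂μ)
      + ε k ^ 3 * (∫ x, iteratedDeriv 3 χ (ε k * x) * R₃ x ∂μ)) atTop (𝓝 (∫ x, R₀ x ∂μ)) := by
    have := (((tendsto_integral_comp_mul_mul (bχ 0 (by norm_num)) I₀ hε).add
      (hε.mul (tendsto_integral_comp_mul_mul (bχ 1 (by norm_num)) I₁ hε))).add
      ((hε.pow 2).mul (tendsto_integral_comp_mul_mul (bχ 2 (by norm_num)) I₂ hε))).add
      ((hε.pow 3).mul (tendsto_integral_comp_mul_mul (bχ 3 le_rfl) I₃ hε))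
    simpa [hχ0] using this
  simp only [key] at hlim
  exact tendsto_nhds_unique hlim tendsto_const_nhds

instance isProbabilityMeasure_PN (μX μY σX σY ρ : ℝ) :
    IsProbabilityMeasure (PN μX μY σX σY ρ) :=
  Measure.isProbabilityMeasure_map (by fun_prop)

section Mean

variable {ν : Measure ℝ} [IsProbabilityMeasure ν] {n : ℕ} {P Q : ℝ → ℝ}

lemma integrable_eval_mul_mean (hν : Integrable id ν) (hP : IsBoundedContinuous P)
    (hQ : IsBoundedContinuous Q) (i : Fin n) :
    Integrable (fun ω : Fin n → ℝ => ω i * P ((∑ j, ω j) / (n : ℝ)) + Q ((∑ j, ω j) / (n : ℝ)))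
      (Measure.pi fun _ : Fin n => ν) := by
  have hm : Continuous fun ω : Fin n → ℝ => (∑ j, ω j) / (n : ℝ) := by fun_prop
  obtain ⟨C, hC⟩ := hP.2
  exact ((integrable_eval hν).mul_bdd (hP.1.comp hm).aestronglyMeasurable
    (ae_of_all _ fun ω => hC _)).add (hQ.hasFiniteMoments_comp hm.measurable.aemeasurable).integrable

lemma integral_eval_mul_mean_eq_zero (hν : Integrable id ν) (hP : IsBoundedContinuous P)
    (hQ : IsBoundedContinuous Q)
    (h : ∀ c, ∫ x, (x * P ((x + c) / (n : ℝ)) + Q ((x + c) / (n : ℝ))) ∂ν = 0) (i : Fin n) :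
    ∫ ω : Fin n → ℝ, (ω i * P ((∑ j, ω j) / (n : ℝ)) + Q ((∑ j, ω j) / (n : ℝ)))
      ∂(Measure.pi fun _ : Fin n => ν) = 0 := by
  obtain ⟨m, rfl⟩ := Nat.exists_eq_add_one.2 i.pos
  have hmp := measurePreserving_piFinSuccAbove (fun _ : Fin (m + 1) => ν) i
  let F : ℝ × (Fin m → ℝ) → ℝ := fun q =>
    q.1 * P ((q.1 + ∑ j, q.2 j) / ((m + 1 : ℕ) : ℝ)) + Q ((q.1 + ∑ j, q.2 j) / ((m + 1 : ℕ) : ℝ))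
  have hF : (fun ω : Fin (m + 1) → ℝ => ω i * P ((∑ j, ω j) / ((m + 1 : ℕ) : ℝ))
      + Q ((∑ j, ω j) / ((m + 1 : ℕ) : ℝ)))
      = F ∘ MeasurableEquiv.piFinSuccAbove (fun _ => ℝ) i := by
    ext ω
    simp only [Fin.sum_univ_succAbove ω i]
    rfl
  have hint := integrable_eval_mul_mean hν hP hQ i
  rw [hF] at hint ⊢
  rw [hmp.integrable_comp_emb (MeasurableEquiv.measurableEmbedding _)] at hint
  change ∫ ω, F (MeasurableEquiv.piFinSuccAbove (fun _ => ℝ) i ω) ∂_ = 0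
  rw [hmp.integral_comp (MeasurableEquiv.measurableEmbedding _), integral_prod_symm _ hint]
  simp only [F, h, integral_zero]

lemma integral_mean_eq_zero (hν : Integrable id ν) (hn : n ≠ 0) (hP : IsBoundedContinuous P)
    (hQ : IsBoundedContinuous Q)
    (h : ∀ c, ∫ x, (x * P ((x + c) / (n : ℝ)) + Q ((x + c) / (n : ℝ))) ∂ν = 0) :
    ∫ x, (x * P x + Q x) ∂(Measure.map (fun ω : Fin n → ℝ => (∑ i, ω i) / (n : ℝ))
      (Measure.pi fun _ : Fin n => ν)) = 0 := by
  have hn' : (n : ℝ) ≠ 0 := Nat.cast_ne_zero.2 hn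
  have hc : Continuous fun x => x * P x + Q x := (continuous_id.mul hP.1).add hQ.1
  rw [integral_map (by fun_prop) hc.aestronglyMeasurable]
  have hsum := integral_finsetSum Finset.univ
    fun i _ => integrable_eval_mul_mean (ν := ν) hν hP hQ (n := n) i
  simp only [integral_eval_mul_mean_eq_zero hν hP hQ h, Finset.sum_const_zero] at hsum
  rw [← mul_zero ((n : ℝ)⁻¹), ← hsum, ← integral_const_mul]
  refine integral_congr_ae (ae_of_all _ fun ω => ?_)
  simp only [Finset.sum_add_distrib, ← Finset.sum_mul, Finset.sum_const, Finset.card_univ,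
    Fintype.card_fin, nsmul_eq_mul]
  field_simp

end Mean

section ProductNormal

variable {μX μY σX σY ρ : ℝ}

lemma PN_eq_map_planeProduct (hσX : 0 < σX) (hσY : 0 < σY) (heq : μX / σX = μY / σY) :
    PN μX μY σX σY ρ = Measure.map (planeProduct (μX / σX) ρ (√(1 - ρ ^ 2)) (σX * σY))
      stdGaussianPlane := by
  have hX : μX = σX * (μX / σX) := by field_simp
  have hY : μY = σY * (μX / σX) := by rw [heq]; field_simp
  rw [PN]
  congr 1
  ext p
  rw [planeProduct]
  nth_rw 1 [hX, hY]
  ring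

lemma integrable_id_PN (hσX : 0 < σX) (hσY : 0 < σY) (heq : μX / σX = μY / σY) :
    Integrable id (PN μX μY σX σY ρ) := by
  rw [PN_eq_map_planeProduct hσX hσY heq, integrable_map_measure aestronglyMeasurable_id
    measurable_planeProduct.aemeasurable]
  exact hasFiniteMoments_planeProduct.integrable

lemma integral_stein_PN (hσX : 0 < σX) (hσY : 0 < σY) (hρ : ρ ^ 2 ≤ 1)
    (heq : μX / σX = μY / σY) {f₀ f₁ f₂ f₃ : ℝ → ℝ}
    (h₀ : ∀ x, HasDerivAt f₀ (f₁ x) x) (h₁ : ∀ x, HasDerivAt f₁ (f₂ x) x)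
    (h₂ : ∀ x, HasDerivAt f₂ (f₃ x) x) (b₀ : IsBoundedContinuous f₀)
    (b₁ : IsBoundedContinuous f₁) (b₂ : IsBoundedContinuous f₂) (b₃ : IsBoundedContinuous f₃) :
    ∫ x, ((σX * σY) ^ 3 * (1 - ρ ^ 2) * (1 + ρ) * x * f₃ x
      + (σX * σY) ^ 2 * (1 + ρ) * ((σX * σY) * (1 - ρ ^ 2) + (3 * ρ - 1) * x) * f₂ x
      + (σX * σY) * ((σX * σY) * (2 * ρ ^ 2 + ρ - 1 - (1 - ρ) * (μX / σX) ^ 2)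
        - (3 * ρ + 1) * x) * f₁ x
      + (x - (σX * σY) * ρ - (σX * σY) * (μX / σX) ^ 2) * f₀ x) ∂(PN μX μY σX σY ρ) = 0 := by
  have c₀ := b₀.1
  have c₁ := b₁.1
  have c₂ := b₂.1
  have c₃ := b₃.1
  rw [PN_eq_map_planeProduct hσX hσY heq, integral_map measurable_planeProduct.aemeasurable
    (by fun_prop : Continuous _).aestronglyMeasurable]
  exact integral_stein_planeProduct (Real.sq_sqrt (by linarith)) h₀ h₁ h₂ b₀ b₁ b₂ b₃

lemma integral_A2_of_hasCompactSupport (hσX : 0 < σX) (hσY : 0 < σY) (hρ : ρ ^ 2 ≤ 1)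
    (heq : μX / σX = μY / σY) {n : ℕ} (hn : n ≠ 0) {f : ℝ → ℝ} (hf : ContDiff ℝ 3 f)
    (hc : HasCompactSupport f) :
    ∫ x, A2 n μX μY σX σY ρ f x ∂(PNbar n μX μY σX σY ρ) = 0 := by
  have hn' : (n : ℝ) ≠ 0 := Nat.cast_ne_zero.2 hn
  have hb : ∀ k ≤ 3, IsBoundedContinuous (iteratedDeriv k f) := fun k hk =>
    .iteratedDeriv_of_hasCompactSupport (n := 3) hf hc hk
  have hd : ∀ k < 3, ∀ x, HasDerivAt (iteratedDeriv k f) (iteratedDeriv (k + 1) f x) x :=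
    fun k hk => ContDiff.hasDerivAt_iteratedDeriv (n := 3) hf hk
  have b₀ := hb 0 (by norm_num)
  have b₁ := hb 1 (by norm_num)
  have b₂ := hb 2 (by norm_num)
  have b₃ := hb 3 le_rfl
  set s := σX * σY with hs
  set r := μX / σX with hr
  have hμ : μX * μY = s * r ^ 2 := by
    rw [sq, hs]
    nth_rw 2 [heq]
    rw [hr]
    field_simp
  have key := integral_mean_eq_zero (integrable_id_PN (ρ := ρ) hσX hσY heq) hn
    (((b₃.const_mul ((s / n) ^ 3 * (1 - ρ ^ 2) * (1 + ρ))).add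
      (b₂.const_mul ((s / n) ^ 2 * (1 + ρ) * (3 * ρ - 1)))).add
      ((b₁.const_mul (-(s / n) * (3 * ρ + 1))).add b₀))
    (((b₂.const_mul (s * ((s / n) ^ 2 * (1 + ρ) * (1 - ρ ^ 2)))).add
      (b₁.const_mul (s * ((s / n) * (2 * ρ ^ 2 + ρ - 1 - (1 - ρ) * r ^ 2))))).add
      (b₀.const_mul (-s * (ρ + r ^ 2)))) ?_
  · rw [PNbar, ← key]
    refine integral_congr_ae (ae_of_all _ fun x => ?_)
    simp only [A2, ← heq, ← hs, ← hr, hμ, iteratedDeriv_zero]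
    field_simp
    ring
  · intro c
    have ha : ∀ x, HasDerivAt (fun x : ℝ => (x + c) / (n : ℝ)) (1 / (n : ℝ)) x := fun x =>
      ((hasDerivAt_id x).add_const c).div_const _
    have ca : Continuous fun x : ℝ => (x + c) / (n : ℝ) := by fun_prop
    have hg : ∀ k < 3, ∀ x, HasDerivAt
        (fun x => (1 / (n : ℝ)) ^ k * iteratedDeriv k f ((x + c) / (n : ℝ)))
        ((1 / (n : ℝ)) ^ (k + 1) * iteratedDeriv (k + 1) f ((x + c) / (n : ℝ))) x :=
      fun k hk x => (((hd k hk _).comp x (ha x)).const_mul _).congr_deriv (by ring)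
    rw [← integral_stein_PN (ρ := ρ) hσX hσY hρ heq (hg 0 (by norm_num)) (hg 1 (by norm_num))
      (hg 2 (by norm_num)) ((b₀.comp ca).const_mul _) ((b₁.comp ca).const_mul _)
      ((b₂.comp ca).const_mul _) ((b₃.comp ca).const_mul _)]
    refine integral_congr_ae (ae_of_all _ fun x => ?_)
    simp only [← hs, ← hr, zero_add, Nat.reduceAdd]
    generalize iteratedDeriv 0 f ((x + c) / (n : ℝ)) = y₀
    generalize iteratedDeriv 1 f ((x + c) / (n : ℝ)) = y₁
    generalize iteratedDeriv 2 f ((x + c) / (n : ℝ)) = y₂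
    generalize iteratedDeriv 3 f ((x + c) / (n : ℝ)) = y₃
    field_simp
    ring

end ProductNormal

/-- Necessity part of the third-order Stein characterisation in the case `μX/σX = μY/σY`,
for `Z̄ₙ`, the mean of `n` independent `PN(μX, μY; σX², σY²; ρ)` random variables:
for every `C³` function `f` with `E|f⁽ᵐ⁾(Z̄ₙ)| < ∞` for `m = 0,1,2` and
`E|Z̄ₙ f⁽ᵐ⁾(Z̄ₙ)| < ∞` for `m = 0,1,2,3`, one has `E[A₂ f (Z̄ₙ)] = 0`. -/
theorem stein_necessity_third_order_PNbar
    (μX μY σX σY ρ : ℝ) (hσX : 0 < σX) (hσY : 0 < σY)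
    (hρ₁ : -1 < ρ) (hρ₂ : ρ < 1) (heq : μX / σX = μY / σY)
    (n : ℕ) (hn : 1 ≤ n)
    (f : ℝ → ℝ) (hf : ContDiff ℝ 3 f)
    (hint : ∀ m ≤ 2, Integrable (iteratedDeriv m f) (PNbar n μX μY σX σY ρ))
    (hintx : ∀ m ≤ 3, Integrable (fun x => x * iteratedDeriv m f x) (PNbar n μX μY σX σY ρ)) :
    ∫ x, A2 n μX μY σX σY ρ f x ∂(PNbar n μX μY σX σY ρ) = 0 := by
  have hρ : ρ ^ 2 ≤ 1 := by nlinarith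
  have h := integral_thirdOrder_eq_zero_of_hasCompactSupport (μ := PNbar n μX μY σX σY ρ)
    (a₃ := (σX * σY / n) ^ 3 * (1 - ρ ^ 2) * (1 + ρ))
    (a₂ := (σX * σY / n) ^ 2 * (1 + ρ) * (3 * ρ - 1))
    (a₁ := -(σX * σY / n) * (3 * ρ + 1)) (a₀ := 1)
    (c₂ := (σX * σY / n) ^ 2 * (1 + ρ) * (n * (σX * σY / n) * (1 - ρ ^ 2)))
    (c₁ := (σX * σY / n) * (n * (σX * σY / n)
      * (2 * ρ ^ 2 + ρ - 1 - (1 - ρ) * (μX / σX) * (μY / σY))))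
    (c₀ := -(n * (σX * σY / n) * ρ) - μX * μY) (fun g hg hc => ?_) hf hint hintx
  · rw [← h]
    refine integral_congr_ae (ae_of_all _ fun x => ?_)
    simp only [A2]
    ring
  · rw [← integral_A2_of_hasCompactSupport hσX hσY hρ heq (Nat.one_le_iff_ne_zero.1 hn) hg hc]
    refine integral_congr_ae (ae_of_all _ fun x => ?_)
    simp only [A2]
    ring
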